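/- Let X be a set, T : X → X a function, κ a real number with κ > 1, and h : X → ℝ a function such that the function x ↦ h(T(x)) − κ·h(x) is bounded on X. Then there exists a unique function h′ : X → ℝ such that h − h′ is bounded on X and h′(T(x)) = κ·h′(x) for all x ∈ X. -/

import Mathlib

open Filter Topology in
/-- A function satisfying `h (T x) = κ * h x` up to a bounded error, with `1 < κ`, is within bounded
distance of a function satisfying the equation exactly. -/
theorem exists_bounded_sub_and_map_eq_mul
    {X : Type*} (T : X → X) {κ : ℝ} (hκ : 1 < κ) (h : X → ℝ)
    (hb : ∃ B : ℝ, ∀ x : X, |h (T x) - κ * h x| ≤ B) :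
    ∃ h' : X → ℝ,
      (∃ B : ℝ, ∀ x : X, |h x - h' x| ≤ B) ∧ (∀ x : X, h' (T x) = κ * h' x) := by
  obtain ⟨B, hB⟩ := hb
  have hκ0 : 0 < κ := one_pos.trans hκ
  have hr : κ⁻¹ < 1 := inv_lt_one_of_one_lt₀ hκ
  let g : X → ℕ → ℝ := fun x n => h (T^[n] x) / κ ^ n
  have hg : ∀ x n, dist (g x n) (g x (n + 1)) ≤ B / κ * κ⁻¹ ^ n := by
    intro x n
    have e : g x (n + 1) - g x n
        = (h (T (T^[n] x)) - κ * h (T^[n] x)) * (κ⁻¹ * κ⁻¹ ^ n) := by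
      simp only [g, Function.iterate_succ_apply', pow_succ, inv_pow]
      field_simp
    have hp : 0 ≤ κ⁻¹ * κ⁻¹ ^ n := by positivity
    rw [dist_comm, Real.dist_eq, e, abs_mul, abs_of_nonneg hp, div_eq_mul_inv, mul_assoc]
    exact mul_le_mul_of_nonneg_right (hB _) hp
  choose h' hlim using fun x =>
    cauchySeq_tendsto_of_complete (cauchySeq_of_le_geometric _ _ hr (hg x))
  refine ⟨h', ⟨B / κ / (1 - κ⁻¹), fun x => ?_⟩, fun x => ?_⟩
  · simpa [g, Real.dist_eq] using dist_le_of_le_geometric_of_tendsto₀ _ _ hr (hg x) (hlim x)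
  · refine tendsto_nhds_unique (hlim (T x)) ?_
    convert ((tendsto_add_atTop_iff_nat 1).2 (hlim x)).const_mul κ using 2 with n
    simp only [g, Function.iterate_succ_apply, pow_succ]
    field_simp

/-- A bounded function satisfying `d (T x) = κ * d x` with `1 < κ` vanishes. -/
theorem eq_zero_of_bounded_of_map_eq_mul
    {X : Type*} {T : X → X} {κ : ℝ} (hκ : 1 < κ) {d : X → ℝ} {B : ℝ}
    (hB : ∀ x, |d x| ≤ B) (hd : ∀ x, d (T x) = κ * d x) (x : X) : d x = 0 := by
  by_contra hx
  have hpos : 0 < |d x| := abs_pos.2 hx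
  have hiter : ∀ n : ℕ, d (T^[n] x) = κ ^ n * d x := by
    intro n
    induction n with
    | zero => simp
    | succ n ih => rw [Function.iterate_succ_apply', hd, ih, pow_succ']; ring
  obtain ⟨n, hn⟩ := pow_unbounded_of_one_lt (B / |d x|) hκ
  have hle := hB (T^[n] x)
  rw [hiter, abs_mul, abs_of_pos (pow_pos (one_pos.trans hκ) n)] at hle
  rw [div_lt_iff₀ hpos] at hn
  exact hle.not_gt hn

/-- Tate's canonical height lemma: if `h ∘ T - κ·h` is bounded on `X`
with `κ > 1`, then there is a unique function `h'` with `h - h'` bounded and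
`h'(T x) = κ · h' x` for all `x`. -/
theorem tate_canonical_height
    {X : Type*} (T : X → X) (κ : ℝ) (hκ : 1 < κ) (h : X → ℝ)
    (hb : ∃ B : ℝ, ∀ x : X, |h (T x) - κ * h x| ≤ B) :
    ∃! h' : X → ℝ,
      (∃ B : ℝ, ∀ x : X, |h x - h' x| ≤ B) ∧ (∀ x : X, h' (T x) = κ * h' x) := by
  obtain ⟨h', ⟨B, hB⟩, hT⟩ := exists_bounded_sub_and_map_eq_mul T hκ h hb
  refine ⟨h', ⟨⟨B, hB⟩, hT⟩, ?_⟩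
  rintro k ⟨⟨C, hC⟩, hkT⟩
  funext x
  refine sub_eq_zero.1 (eq_zero_of_bounded_of_map_eq_mul (T := T) (d := fun x => k x - h' x)
    (B := C + B) hκ (fun y => ?_) (fun y => ?_) x)
  · calc |k y - h' y| ≤ |k y - h y| + |h y - h' y| := abs_sub_le _ _ _
      _ ≤ C + B := add_le_add (abs_sub_comm (k y) (h y) ▸ hC y) (hB y)
  · rw [hkT, hT, mul_sub]
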